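/- arXiv:2202.02061 — 7 statements merged into one kernel-verified Lean document; each statement's English description precedes it below -/
import Mathlib

section
/- Let (C, ⊗, 𝟙) be a symmetric monoidal category and X, Y : ℕ → C sequences of objects. There is a bijection between iSeq(X, Y) and Σ (M₀ : C), Hom(X₀, M₀ ⊗ Y₀) × iSeq(M₀·tail X, tail Y); concretely, the map sending an intensional sequence (M, (fₙ)ₙ) to the triple consisting of M₀, the morphism (λ_{X₀})⁻¹ ≫ f₀ : X₀ ⟶ M₀ ⊗ Y₀, and the intensional sequence with memories (M₁, M₂, …) and components (f₁, f₂, …) is a bijection. (This is the fixpoint property of intensional sequences, the core of Theorem 3.3.) -/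
open CategoryTheory MonoidalCategory

universe v u

variable {C : Type u} [Category.{v} C] [MonoidalCategory C] [SymmetricCategory C]

/-- The memory object at time `n - 1`, with the convention `M₋₁ = 𝟙`. -/
def prevMem (M : ℕ → C) : ℕ → C
  | 0 => 𝟙_ C
  | n + 1 => M n

/-- Intensional sequences from `X` to `Y`: a sequence of memories `M` together with
morphisms `fₙ : M_{n-1} ⊗ Xₙ ⟶ Mₙ ⊗ Yₙ`. -/
def iSeq (X Y : ℕ → C) : Type _ :=
  Σ M : ℕ → C, ∀ n : ℕ, (prevMem M n ⊗ X n ⟶ M n ⊗ Y n)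

/-- The sequence `M₀ · X = (M₀ ⊗ X₀, X₁, X₂, …)`. -/
def actCons (M₀ : C) (X : ℕ → C) : ℕ → C
  | 0 => M₀ ⊗ X 0
  | n + 1 => X (n + 1)

/-- The canonical "unfolding" map sending an intensional sequence `(M, f)` to the triple
consisting of `M₀`, the morphism `(λ_{X₀})⁻¹ ≫ f₀ : X₀ ⟶ M₀ ⊗ Y₀`, and the intensional
sequence with memories `(M₁, M₂, …)` and components `(f₁, f₂, …)`. -/
def unfoldMap (X Y : ℕ → C) (s : iSeq X Y) :
    Σ M₀ : C, (X 0 ⟶ M₀ ⊗ Y 0) ×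
      iSeq (actCons M₀ fun n => X (n + 1)) (fun n => Y (n + 1)) :=
  ⟨s.1 0, (λ_ (X 0)).inv ≫ s.2 0,
    ⟨fun n => s.1 (n + 1), fun n =>
      match n with
      | 0 => (λ_ (s.1 0 ⊗ X 1)).hom ≫ s.2 1
      | n + 1 => s.2 (n + 2)⟩⟩

/-- Intensional sequences with pointwise equal memories and components are equal. -/
theorem iSeq_ext {X Y : ℕ → C} {s t : iSeq X Y} (hM : ∀ n, s.1 n = t.1 n)
    (hf : ∀ n, s.2 n ≍ t.2 n) : s = t := by
  obtain ⟨M, f⟩ := s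
  obtain ⟨N, g⟩ := t
  obtain rfl : M = N := funext hM
  obtain rfl : f = g := funext fun n => eq_of_heq (hf n)
  rfl

/-- The sequence `(M₀, N₀, N₁, …)` of memories. -/
def consMem (M₀ : C) (N : ℕ → C) : ℕ → C
  | 0 => M₀
  | n + 1 => N n

/-- The inverse of `unfoldMap`. -/
def foldMap (X Y : ℕ → C)
    (t : Σ M₀ : C, (X 0 ⟶ M₀ ⊗ Y 0) ×
      iSeq (actCons M₀ fun n => X (n + 1)) (fun n => Y (n + 1))) : iSeq X Y :=
  ⟨consMem t.1 t.2.2.1, fun n =>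
    match n with
    | 0 => (λ_ (X 0)).hom ≫ t.2.1
    | 1 => (λ_ (t.1 ⊗ X 1)).inv ≫ t.2.2.2 0
    | n + 2 => t.2.2.2 (n + 1)⟩

theorem foldMap_unfoldMap (X Y : ℕ → C) (s : iSeq X Y) :
    foldMap X Y (unfoldMap X Y s) = s := by
  refine iSeq_ext (fun n => ?_) (fun n => ?_)
  · cases n <;> rfl
  · match n with
    | 0 => exact heq_of_eq (Iso.hom_inv_id_assoc (λ_ (X 0)) (s.2 0))
    | 1 => exact heq_of_eq (Iso.inv_hom_id_assoc (λ_ (s.1 0 ⊗ X 1)) (s.2 1))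
    | n + 2 => rfl

theorem unfoldMap_foldMap (X Y : ℕ → C)
    (t : Σ M₀ : C, (X 0 ⟶ M₀ ⊗ Y 0) ×
      iSeq (actCons M₀ fun n => X (n + 1)) (fun n => Y (n + 1))) :
    unfoldMap X Y (foldMap X Y t) = t := by
  obtain ⟨M₀, g, s⟩ := t
  refine Sigma.ext rfl (heq_of_eq (Prod.ext ?_ (iSeq_ext (fun _ => rfl) fun n => ?_)))
  · exact Iso.inv_hom_id_assoc (λ_ (X 0)) g
  · match n with
    | 0 => exact heq_of_eq (Iso.hom_inv_id_assoc (λ_ (M₀ ⊗ X 1)) (s.2 0))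
    | n + 1 => rfl

/-- Fixpoint property of intensional sequences: the canonical unfolding map is a bijection
`iSeq(X, Y) ≃ Σ M₀, Hom(X₀, M₀ ⊗ Y₀) × iSeq(M₀ · tail X, tail Y)`. -/
theorem unfoldMap_bijective (X Y : ℕ → C) :
    Function.Bijective (unfoldMap (C := C) X Y) :=
  Function.bijective_iff_has_inverse.mpr
    ⟨foldMap X Y, foldMap_unfoldMap X Y, unfoldMap_foldMap X Y⟩
end

section
/- Adamek's theorem: Let D be a category with a terminal object 1 and limits of ℕᵒᵖ-indexed chains, and let F : D ⥤ D be an endofunctor. Consider the terminal sequence 1 ⟵ F1 ⟵ F²1 ⟵ ⋯, the ℕᵒᵖ-chain whose n-th object is Fⁿ1 and whose connecting morphisms are Fⁿ applied to the unique morphism F1 ⟶ 1, and let L be its limit. Applying F to the limit cone and using the unique morphism F(L) ⟶ 1 yields a cone of F(L) over the terminal sequence, hence a canonical morphism c : F(L) ⟶ L. If c is an isomorphism, then the coalgebra (L, c⁻¹) is a terminal object in the category of F-coalgebras. -/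
open CategoryTheory Limits Opposite

universe v u

variable {D : Type u} [Category.{v} D]

noncomputable section

/-- The objects `Fⁿ(1)` of the terminal sequence of an endofunctor `F`. -/
def towerObj (F : D ⥤ D) [HasTerminal D] : ℕ → D
  | 0 => ⊤_ D
  | n + 1 => F.obj (towerObj F n)

/-- The connecting morphisms `Fⁿ⁺¹(1) ⟶ Fⁿ(1)` of the terminal sequence, given by
`Fⁿ` applied to the unique morphism `F(1) ⟶ 1`. -/
def towerHom (F : D ⥤ D) [HasTerminal D] : ∀ n : ℕ, towerObj F (n + 1) ⟶ towerObj F n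
  | 0 => terminal.from _
  | n + 1 => F.map (towerHom F n)

/-- The terminal sequence `1 ⟵ F1 ⟵ FF1 ⟵ ⋯` of an endofunctor `F`, as a functor
`ℕᵒᵖ ⥤ D`. -/
def terminalSequence (F : D ⥤ D) [HasTerminal D] : ℕᵒᵖ ⥤ D :=
  Functor.ofOpSequence (towerHom F)

/-- The components `V ⟶ Fⁿ(1)` of the canonical cone over the terminal sequence induced by an
`F`-coalgebra. -/
def towerProj {F : D ⥤ D} [HasTerminal D] (V : Endofunctor.Coalgebra F) :
    ∀ n : ℕ, V.V ⟶ towerObj F n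
  | 0 => terminal.from _
  | n + 1 => V.str ≫ F.map (towerProj V n)

lemma towerProj_comp_towerHom {F : D ⥤ D} [HasTerminal D] (V : Endofunctor.Coalgebra F) (n : ℕ) :
    towerProj V (n + 1) ≫ towerHom F n = towerProj V n := by
  induction n with
  | zero => exact terminal.hom_ext _ _
  | succ n ih =>
    change (V.str ≫ F.map (towerProj V (n + 1))) ≫ F.map (towerHom F n) =
      V.str ≫ F.map (towerProj V n)
    rw [Category.assoc, ← F.map_comp, ih]

/-- The canonical cone over the terminal sequence induced by an `F`-coalgebra. -/
def coalgebraCone {F : D ⥤ D} [HasTerminal D] (V : Endofunctor.Coalgebra F) :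
    Cone (terminalSequence F) where
  pt := V.V
  π := NatTrans.ofOpSequence (F := (Functor.const ℕᵒᵖ).obj V.V) (G := terminalSequence F)
    (towerProj V) fun n => by
      exact (Category.id_comp _).trans ((towerProj_comp_towerHom V n).symm.trans
        (congrArg (towerProj V (n + 1) ≫ ·)
          (Functor.ofOpSequence_map_homOfLE_succ (towerHom F) n).symm))

/-- The morphism from an `F`-coalgebra to the limit of the terminal sequence. -/
def coalgebraLift {F : D ⥤ D} [HasTerminal D] [HasLimitsOfShape ℕᵒᵖ D]
    (V : Endofunctor.Coalgebra F) : V.V ⟶ limit (terminalSequence F) :=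
  limit.lift (terminalSequence F) (coalgebraCone V)

lemma coalgebraLift_π {F : D ⥤ D} [HasTerminal D] [HasLimitsOfShape ℕᵒᵖ D]
    (V : Endofunctor.Coalgebra F) (n : ℕ) :
    coalgebraLift V ≫ limit.π (terminalSequence F) (op n) = towerProj V n :=
  limit.lift_π (coalgebraCone V) (op n)

/-- A coalgebra morphism into `(L, c⁻¹)` is one whose underlying morphism is compatible with `c`. -/
lemma str_comp_map_eq_comp_inv_iff {F : D ⥤ D} (V : Endofunctor.Coalgebra F) {L : D}
    (c : F.obj L ⟶ L) [IsIso c] (g : V.V ⟶ L) :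
    V.str ≫ F.map g = g ≫ inv c ↔ V.str ≫ F.map g ≫ c = g := by
  rw [IsIso.eq_comp_inv, Category.assoc]

lemma eq_coalgebraLift_of_comp_π {F : D ⥤ D} [HasTerminal D] [HasLimitsOfShape ℕᵒᵖ D]
    (V : Endofunctor.Coalgebra F) (g : V.V ⟶ limit (terminalSequence F))
    (hg : ∀ n : ℕ, g ≫ limit.π (terminalSequence F) (op n) = towerProj V n) :
    g = coalgebraLift V :=
  limit.hom_ext fun j => (hg j.unop).trans (coalgebraLift_π V j.unop).symm

/-- **Adamek's theorem.**  Let `D` have a terminal object and limits of `ℕᵒᵖ`-chains, let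
`L` be the limit of the terminal sequence of `F`, and let `c : F(L) ⟶ L` be the canonical
morphism (characterized by `c ≫ π_{n+1} = F(π_n)`; its component at `0` is forced since
the object there is terminal).  If `c` is an isomorphism, then the coalgebra `(L, c⁻¹)`
is terminal in the category of `F`-coalgebras. -/
theorem adamek [HasTerminal D] [HasLimitsOfShape ℕᵒᵖ D] (F : D ⥤ D)
    (c : F.obj (limit (terminalSequence F)) ⟶ limit (terminalSequence F))
    (hc : ∀ n : ℕ, c ≫ limit.π (terminalSequence F) (op (n + 1)) =
      F.map (limit.π (terminalSequence F) (op n)))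
    [IsIso c] :
    Nonempty (IsTerminal
      (⟨limit (terminalSequence F), inv c⟩ : Endofunctor.Coalgebra F)) := by
  have fixed_iff (V : Endofunctor.Coalgebra F) (g : V.V ⟶ limit (terminalSequence F)) :
      V.str ≫ F.map g ≫ c = g ↔ g = coalgebraLift V := by
    have comp_π (n : ℕ) : (V.str ≫ F.map g ≫ c) ≫ limit.π (terminalSequence F) (op (n + 1)) =
        V.str ≫ F.map (g ≫ limit.π (terminalSequence F) (op n)) := by
      rw [Category.assoc, Category.assoc, hc, F.map_comp]
      rfl
    constructor
    · intro hg
      refine eq_coalgebraLift_of_comp_π V g fun n => ?_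
      induction n with
      | zero => exact terminal.hom_ext _ _
      | succ n ih =>
        rw [← hg, comp_π, ih]
        rfl
    · intro hg
      refine (eq_coalgebraLift_of_comp_π V _ fun n => ?_).trans hg.symm
      cases n with
      | zero => exact terminal.hom_ext _ _
      | succ n =>
        rw [comp_π, hg, coalgebraLift_π]
        rfl
  refine ⟨IsTerminal.ofUniqueHom (fun V => ⟨coalgebraLift V,
    (str_comp_map_eq_comp_inv_iff V c _).2 ((fixed_iff V _).2 rfl)⟩) fun V m => ?_⟩
  exact Endofunctor.Coalgebra.ext
    ((fixed_iff V m.f).1 ((str_comp_map_eq_comp_inv_iff V c m.f).1 m.h))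
end
end

section
/- Discrete conditionals (the Markov category Stoch has conditionals): For all types A, X, Y and every function f : A → PMF (X × Y), there exist functions m : A → PMF X and c : X → A → PMF Y such that for every a : A, m a = (f a).map Prod.fst, and f a = (m a).bind (fun x => (c x a).map (fun y => (x, y))). -/
/-- The first marginal of a joint distribution sums out the second coordinate. -/
theorem PMF.map_fst_apply {X Y : Type*} (p : PMF (X × Y)) (x : X) :
    p.map Prod.fst x = ∑' y, p (x, y) := by
  classical
  rw [PMF.map_apply, ENNReal.tsum_prod', tsum_eq_single x fun x' hx' => by simp [hx'.symm]]
  simp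

/-- The mass that the pairs `(x, y)` receive when `y` is drawn from `c x` and `x` from `m`. -/
theorem PMF.bind_map_mk_apply {X Y : Type*} (m : PMF X) (c : X → PMF Y) (x : X) (y : Y) :
    (m.bind fun x => (c x).map fun y => (x, y)) (x, y) = m x * c x y := by
  classical
  rw [PMF.bind_apply, tsum_eq_single x fun x' hx' => by simp [PMF.map_apply, hx'.symm],
    PMF.map_apply, tsum_eq_single y fun y' hy' => by simp [hy'.symm]]
  simp

/-- At every `x` a joint distribution has a conditional distribution on the second coordinate. -/
theorem PMF.exists_conditional {X Y : Type*} (p : PMF (X × Y)) (x : X) :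
    ∃ q : PMF Y, ∀ y, p (x, y) = p.map Prod.fst x * q y := by
  have hsum := p.map_fst_apply x
  by_cases h0 : p.map Prod.fst x = 0
  · obtain ⟨z, -⟩ := p.support_nonempty
    refine ⟨PMF.pure z.2, fun y => ?_⟩
    rw [h0, zero_mul]
    exact ENNReal.tsum_eq_zero.mp (hsum.symm.trans h0) y
  · have htop : p.map Prod.fst x ≠ ⊤ := PMF.apply_ne_top _ x
    refine ⟨PMF.normalize (fun y => p (x, y)) (hsum ▸ h0) (hsum ▸ htop), fun y => ?_⟩
    rw [PMF.normalize_apply, ← hsum, mul_left_comm, ENNReal.mul_inv_cancel h0 htop, mul_one]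

/-- **Discrete conditionals** (the Markov category `Stoch` has conditionals): every
kernel `f : A → PMF (X × Y)` factors as its marginal `m` on `X` followed by a
conditional `c : X → A → PMF Y`. -/
theorem pmf_conditionals {A X Y : Type*} (f : A → PMF (X × Y)) :
    ∃ (m : A → PMF X) (c : X → A → PMF Y),
      (∀ a, m a = (f a).map Prod.fst) ∧
      (∀ a, f a = (m a).bind fun x => (c x a).map fun y => (x, y)) := by
  choose c hc using fun x a => (f a).exists_conditional x
  refine ⟨fun a => (f a).map Prod.fst, c, fun _ => rfl, fun a => PMF.ext fun ⟨x, y⟩ => ?_⟩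
  rw [PMF.bind_map_mk_apply _ (fun x => c x a), hc]
end

section
/- Discrete ranges (the Markov category Stoch has ranges): For all types A, B and every function f : A → PMF B, there exists a (deterministic) function r : A × B → A × B such that: (i) for every a : A, (f a).map (fun b => (a, b)) = (f a).map (fun b => r (a, b)); and (ii) for all types Z, C and all functions g, h : A → B → Z → PMF C, if for all a : A and z : Z one has (f a).bind (fun b => (g a b z).map (fun c => (b, c))) = (f a).bind (fun b => (h a b z).map (fun c => (b, c))), then for all a : A, b : B and z : Z, g (r (a, b)).1 (r (a, b)).2 z = h (r (a, b)).1 (r (a, b)).2 z. -/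
universe u v w x

theorem PMF.map_congr_of_support {α : Type*} {β : Type*} (p : PMF α) {f g : α → β}
    (h : ∀ a ∈ p.support, f a = g a) : p.map f = p.map g := by
  classical
  ext y
  simp only [PMF.map_apply]
  refine tsum_congr fun a => ?_
  by_cases ha : p a = 0
  · simp [ha]
  · rw [h a ((p.mem_support_iff a).2 ha)]

theorem PMF.bind_map_prodMk_apply {α : Type*} {β : Type*} (p : PMF α) (g : α → PMF β)
    (a : α) (b : β) :
    (p.bind fun a => (g a).map fun b => (a, b)) (a, b) = p a * g a b := by
  classical
  rw [PMF.bind_apply, tsum_eq_single a]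
  · simp
  · intro a' ha'
    simp [ha'.symm]

/-- If two kernels have the same joint law with their input, they agree on its support. -/
theorem PMF.eq_of_bind_map_prodMk_eq {α : Type*} {β : Type*} {p : PMF α} {g h : α → PMF β}
    (H : (p.bind fun a => (g a).map fun b => (a, b)) = p.bind fun a => (h a).map fun b => (a, b))
    {a : α} (ha : a ∈ p.support) : g a = h a := by
  ext b
  have hab := DFunLike.congr_fun H (a, b)
  rw [PMF.bind_map_prodMk_apply, PMF.bind_map_prodMk_apply] at hab
  exact (ENNReal.mul_right_inj ((p.mem_support_iff a).1 ha) (p.apply_ne_top a)).1 hab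

/-- **Discrete ranges** (the Markov category `Stoch` has ranges): for every kernel
`f : A → PMF B` there is a deterministic function `r : A × B → A × B` which (i) does not
change the output of `f` paired with its input, and (ii) has the range property. -/
theorem pmf_ranges {A : Type u} {B : Type v} (f : A → PMF B) :
    ∃ r : A × B → A × B,
      (∀ a, (f a).map (fun b => (a, b)) = (f a).map fun b => r (a, b)) ∧
      (∀ (Z : Type w) (C : Type x) (g h : A → B → Z → PMF C),
        (∀ a z, ((f a).bind fun b => (g a b z).map fun c => (b, c)) =
            ((f a).bind fun b => (h a b z).map fun c => (b, c))) →
        ∀ a b z, g (r (a, b)).1 (r (a, b)).2 z = h (r (a, b)).1 (r (a, b)).2 z) := by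
  classical
  choose s hs using fun a => (f a).support_nonempty
  refine ⟨fun q => (q.1, if q.2 ∈ (f q.1).support then q.2 else s q.1), fun a => ?_, ?_⟩
  · exact PMF.map_congr_of_support _ fun b hb => by simp only [if_pos hb]
  · intro Z C g h H a b z
    refine PMF.eq_of_bind_map_prodMk_eq (g := fun b => g a b z) (h := fun b => h a b z) (H a z) ?_
    dsimp only
    split_ifs with hb
    exacts [hb, hs a]
end

section
/- Controlled stochastic processes are closed under componentwise Kleisli composition: if f is a controlled stochastic process from X to Y and g is a controlled stochastic process from Y to Z, then the family h defined by h n x := (f n x).bind (g n) is a controlled stochastic process from X to Z (i.e., it satisfies causality). -/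
universe u

/-- Causality (the marginalisation property) for a family of kernels
`f n : (Π i : Fin (n+1), X i) → PMF (Π i : Fin (n+1), Y i)`: marginalising the
`(n+1)`-st stage over its last output component recovers the `n`-th stage. -/
def Causal {X Y : ℕ → Type u}
    (f : ∀ n : ℕ, (∀ i : Fin (n + 1), X i) → PMF (∀ i : Fin (n + 1), Y i)) : Prop :=
  ∀ (n : ℕ) (x : ∀ i : Fin (n + 2), X i),
    ((f (n + 1) x).map fun ys => fun i : Fin (n + 1) => ys i.castSucc) =
      f n fun i => x i.castSucc

/-- Controlled stochastic processes are closed under componentwise Kleisli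
composition: if `f : X → Y` and `g : Y → Z` are causal, then so is
`n ↦ x ↦ (f n x).bind (g n)`. -/
theorem causal_comp {X Y Z : ℕ → Type u}
    (f : ∀ n : ℕ, (∀ i : Fin (n + 1), X i) → PMF (∀ i : Fin (n + 1), Y i))
    (g : ∀ n : ℕ, (∀ i : Fin (n + 1), Y i) → PMF (∀ i : Fin (n + 1), Z i))
    (hf : Causal f) (hg : Causal g) :
    Causal (fun n x => (f n x).bind (g n)) := by
  intro n x
  beta_reduce
  rw [PMF.map_bind, ← hf n x, PMF.bind_map]
  congr 1
  funext y
  exact hg n y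
end

section
/- Controlled stochastic processes are closed under parallel composition (tensoring): if f is a controlled stochastic process from X to Y and f' is a controlled stochastic process from X' to Y', then the family h from the sequence (fun n => X n × X' n) to the sequence (fun n => Y n × Y' n) defined by h n w := (f n (fun i => (w i).1)).bind (fun ys => (f' n (fun i => (w i).2)).map (fun ys' => fun i => (ys i, ys' i))) is a controlled stochastic process (i.e., it satisfies causality). -/
universe u

/-- Controlled stochastic processes are closed under parallel composition (tensoring):
if `f : X → Y` and `f' : X' → Y'` are causal, then so is their tensor, sampling from
`f` and then independently from `f'`. -/
theorem causal_tensor {X X' Y Y' : ℕ → Type u}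
    (f : ∀ n : ℕ, (∀ i : Fin (n + 1), X i) → PMF (∀ i : Fin (n + 1), Y i))
    (f' : ∀ n : ℕ, (∀ i : Fin (n + 1), X' i) → PMF (∀ i : Fin (n + 1), Y' i))
    (hf : Causal f) (hf' : Causal f') :
    Causal (X := fun n => X n × X' n) (Y := fun n => Y n × Y' n)
      (fun n w =>
        (f n fun i => (w i).1).bind fun ys =>
          (f' n fun i => (w i).2).map fun ys' => fun i => (ys i, ys' i)) := by
  intro n w
  have h := hf n fun i => (w i).1
  have h' := hf' n fun i => (w i).2
  dsimp only at h h' ⊢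
  erw [← h, ← h']
  rw [PMF.map_bind, PMF.bind_map]
  congr 1
  funext ys
  simp only [Function.comp_def]
  rw [PMF.map_comp, PMF.map_comp]
  rfl
end

section
/- Factoring a stochastic process as iterated conditionals: For every controlled stochastic process f from X to Y there exists a family of conditionals c : Π (n : ℕ), (Π (i : Fin n), Y i) → (Π (i : Fin (n+1)), X i) → PMF (Y n) such that: for every x : Π (i : Fin 1), X i, f 0 x = (c 0 Fin.elim0 x).map (fun y => fun _ => y); and for every n and every x : Π (i : Fin (n+2)), X i, f (n+1) x = (f n (restriction of x to Fin (n+1))).bind (fun ys => (c (n+1) ys x).map (fun y => Fin.snoc ys y)). -/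
universe u

open Classical in
/-- The conditional distribution of `p` given that `g` takes the value `b`, with junk value `p` if
that event is null. -/
noncomputable def PMF.condFiber {α β : Type*} (p : PMF α) (g : α → β) (b : β) : PMF α :=
  if h : ∃ a ∈ g ⁻¹' {b}, a ∈ p.support then p.filter (g ⁻¹' {b}) h else p

theorem PMF.map_apply_eq_zero_of_mem_support_condFiber {α β : Type*} (p : PMF α) (g : α → β)
    {a : α} {b : β} (ha : a ∈ (p.condFiber g b).support) (hab : g a ≠ b) : p.map g b = 0 := by
  by_cases h : ∃ a ∈ g ⁻¹' {b}, a ∈ p.support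
  · rw [condFiber, dif_pos h, mem_support_filter_iff] at ha
    exact absurd ha.1 hab
  · rw [apply_eq_zero_iff, mem_support_map_iff]
    rintro ⟨a', ha', rfl⟩
    exact h ⟨a', rfl, ha'⟩

theorem PMF.map_apply_eq_tsum_indicator {α β : Type*} (p : PMF α) (g : α → β) (b : β) :
    p.map g b = ∑' a, (g ⁻¹' {b}).indicator p a := by
  classical
  rw [map_apply]
  refine tsum_congr fun a => ?_
  simp [Set.indicator_apply, eq_comm]

theorem PMF.map_apply_mul_condFiber_apply {α β : Type*} (p : PMF α) (g : α → β) (a : α) :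
    p.map g (g a) * p.condFiber g (g a) a = p a := by
  by_cases h : ∃ a' ∈ g ⁻¹' {g a}, a' ∈ p.support
  · have h0 : p.map g (g a) ≠ 0 := by
      obtain ⟨a', ha', hp⟩ := h
      exact (mem_support_iff _ _).1 ((mem_support_map_iff ..).2 ⟨a', hp, ha'⟩)
    rw [condFiber, dif_pos h, filter_apply, ← map_apply_eq_tsum_indicator,
      Set.indicator_of_mem (by simp), mul_left_comm,
      ENNReal.mul_inv_cancel h0 (apply_ne_top _ _), mul_one]
  · have hp : p a = 0 := by
      by_contra hp
      exact h ⟨a, rfl, (mem_support_iff _ _).2 hp⟩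
    rw [condFiber, dif_neg h, hp, mul_zero]

/-- Disintegration of a `PMF` along a map. -/
theorem PMF.map_bind_condFiber {α β : Type*} (p : PMF α) (g : α → β) :
    (p.map g).bind (p.condFiber g) = p := by
  ext a
  rw [bind_apply, tsum_eq_single (g a), map_apply_mul_condFiber_apply]
  intro b hb
  by_cases ha : p.condFiber g b a = 0
  · rw [ha, mul_zero]
  · rw [p.map_apply_eq_zero_of_mem_support_condFiber g ((mem_support_iff _ _).2 ha) hb.symm,
      zero_mul]

theorem PMF.bind_congr_of_mem_support {α β : Type*} (p : PMF α) {k l : α → PMF β}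
    (h : ∀ a ∈ p.support, k a = l a) : p.bind k = p.bind l := by
  ext b
  simp only [bind_apply]
  refine tsum_congr fun a => ?_
  by_cases ha : p a = 0
  · simp [ha]
  · rw [h a ((mem_support_iff _ _).2 ha)]

theorem PMF.map_eq_self_of_mem_support {α : Type*} (p : PMF α) {g : α → α}
    (h : ∀ a ∈ p.support, g a = a) : p.map g = p := by
  rw [← bind_pure_comp, p.bind_congr_of_mem_support (l := pure), bind_pure]
  intro a ha
  simp [h a ha]

/-- A distribution on tuples is its marginal on the initial entries followed by the conditional
distribution of the last entry. -/
theorem PMF.bind_init_snoc_last {n : ℕ} {Y : ℕ → Type*} (p : PMF (∀ i : Fin (n + 1), Y i)) :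
    p = (p.map fun ys => fun i : Fin n => ys i.castSucc).bind fun zs =>
      ((p.condFiber (fun ys => fun i : Fin n => ys i.castSucc) zs).map
        fun ys => ys (Fin.last n)).map
        fun y => (Fin.snoc zs y : ∀ i : Fin (n + 1), Y i) := by
  conv_lhs => rw [← p.map_bind_condFiber fun ys => fun i : Fin n => ys i.castSucc]
  refine bind_congr_of_mem_support _ fun zs hzs => ?_
  rw [map_comp]
  refine (map_eq_self_of_mem_support _ fun ys hys => ?_).symm
  have hinit : (fun i : Fin n => ys i.castSucc) = zs := by
    by_contra hne
    exact (mem_support_iff _ _).1 hzs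
      (p.map_apply_eq_zero_of_mem_support_condFiber _ hys hne)
  subst hinit
  exact Fin.snoc_init_self (α := fun i => Y i) ys

/-- **Factoring a stochastic process as iterated conditionals**: every controlled
stochastic process `f` from `X` to `Y` admits a family of conditionals
`c n : (Π i : Fin n, Y i) → (Π i : Fin (n+1), X i) → PMF (Y n)` such that the `0`-th
stage of `f` is given by `c 0` and each later stage of `f` is obtained from the previous
one by sampling the next output from the conditional. -/
theorem causal_factor_conditionals {X Y : ℕ → Type u}
    (f : ∀ n : ℕ, (∀ i : Fin (n + 1), X i) → PMF (∀ i : Fin (n + 1), Y i))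
    (hf : Causal f) :
    ∃ c : ∀ n : ℕ, (∀ i : Fin n, Y i) → (∀ i : Fin (n + 1), X i) → PMF (Y n),
      (∀ x : ∀ i : Fin 1, X i,
        f 0 x = (c 0 (fun i => i.elim0) x).map fun y => Fin.snoc (fun i => i.elim0) y) ∧
      (∀ (n : ℕ) (x : ∀ i : Fin (n + 2), X i),
        f (n + 1) x = (f n fun i => x i.castSucc).bind fun ys =>
          (c (n + 1) ys x).map fun y => Fin.snoc ys y) := by
  refine ⟨fun n zs x => ((f n x).condFiber (fun ys => fun i : Fin n => ys i.castSucc) zs).map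
    fun ys => ys (Fin.last n), fun x => ?_, fun n x => ?_⟩
  · have hinit : ((f 0 x).map fun ys => fun i : Fin 0 => ys i.castSucc) =
        PMF.pure fun i => i.elim0 := by
      rw [← (f 0 x).map_const]
      congr 1
      funext ys i
      exact i.elim0
    have h := (f 0 x).bind_init_snoc_last
    rw [hinit, PMF.pure_bind] at h
    exact h
  · rw [← hf n x]
    exact (f (n + 1) x).bind_init_snoc_last
end
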